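/- (Asymptotic Stability, main theorem.) Choose Q > 0 arbitrarily; let P > 0 solve the discrete algebraic Riccati equation P = A^TPA − A^TPB(B^TPB)^{-1}B^TPA + Q; compute c₁ := max_{i=0,…,N−1} λ_max(Φ_i^TPΦ_i(G^TG)^{-1}), ρ := 1 − λ_min(QP^{-1}) ∈ [0,1), c := (1−ρ)^{-1}(1−ρ^N)c₁; choose ℰ with 0 < ℰ < (1−ρ)P/c and set W := (P − Q) + ℰ. Consider the noise-free networked control loop x(k+1) = Ax(k) + Bu(k) under bounded packet dropouts: successful transmission instants k_0 = 0 < k_1 < k_2 < … with k_{i+1} − k_i − 1 ≤ N − 1 for all i; at each k_i an arbitrary feasible packet u(x(k_i)) ∈ F_W(x(k_i)) (in particular, any ℓ⁰-minimizing packet subject to ‖Gu − Hx(k_i)‖₂² ≤ x(k_i)^TWx(k_i)) is buffered, and the plant input for k = k_i + l (l = 0,…,m_i) is the (l+1)-th entry of that packet. Then the closed loop is asymptotically stable: x(k) → 0 as k → ∞ for every initial state x(0). -/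

import Mathlib

open Matrix Filter Topology

noncomputable section

/-- The block lower-triangular matrix `Φ ∈ ℝ^{nN×N}` whose (i,j)-th `n×1` block
(0-indexed) is `A^{i-j}B` for `i ≥ j` and `0` otherwise. -/
def Phi (n N : ℕ) (A : Matrix (Fin n) (Fin n) ℝ) (B : Fin n → ℝ) :
    Matrix (Fin N × Fin n) (Fin N) ℝ :=
  Matrix.of fun p j =>
    if (j : ℕ) ≤ (p.1 : ℕ) then ((A ^ ((p.1 : ℕ) - (j : ℕ))) *ᵥ B) p.2 else 0

/-- `Φ_i ∈ ℝ^{n×N}`, the (i+1)-th row block of `Φ`,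
i.e. `Φ_i = [A^i B, A^{i-1} B, …, B, 0, …, 0]`. -/
def PhiBlock (n N : ℕ) (A : Matrix (Fin n) (Fin n) ℝ) (B : Fin n → ℝ) (i : Fin N) :
    Matrix (Fin n) (Fin N) ℝ :=
  Matrix.of fun r j => Phi n N A B (i, r) j

/-- `Υ := [A; A²; …; A^N] ∈ ℝ^{nN×n}`. -/
def Upsilon (n N : ℕ) (A : Matrix (Fin n) (Fin n) ℝ) :
    Matrix (Fin N × Fin n) (Fin n) ℝ :=
  Matrix.of fun p s => (A ^ ((p.1 : ℕ) + 1)) p.2 s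

/-- `Q̄ := blockdiag(Q, …, Q, P)` with `N−1` copies of `Q` followed by `P`. -/
def Qbar (n N : ℕ) (Q P : Matrix (Fin n) (Fin n) ℝ) :
    Matrix (Fin N × Fin n) (Fin N × Fin n) ℝ :=
  Matrix.of fun p q =>
    if p.1 = q.1 then (if (p.1 : ℕ) = N - 1 then P else Q) p.2 q.2 else 0

/-- The cost `u ↦ ‖Gu − Hx‖₂²`. -/
def Jcost {n N : ℕ} (G : Matrix (Fin N × Fin n) (Fin N) ℝ)
    (H : Matrix (Fin N × Fin n) (Fin n) ℝ) (x : Fin n → ℝ) (u : Fin N → ℝ) : ℝ :=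
  (G *ᵥ u - H *ᵥ x) ⬝ᵥ (G *ᵥ u - H *ᵥ x)

/-- The feasible set `F_W(x) := {u ∈ ℝ^N : ‖Gu − Hx‖₂² ≤ xᵀWx}`. -/
def Feas {n N : ℕ} (G : Matrix (Fin N × Fin n) (Fin N) ℝ)
    (H : Matrix (Fin N × Fin n) (Fin n) ℝ) (W : Matrix (Fin n) (Fin n) ℝ)
    (x : Fin n → ℝ) : Set (Fin N → ℝ) :=
  {u | Jcost G H x u ≤ x ⬝ᵥ (W *ᵥ x)}

/-- The least-squares solution `u*(x) := (GᵀG)⁻¹GᵀHx`. -/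
def uStar {n N : ℕ} (G : Matrix (Fin N × Fin n) (Fin N) ℝ)
    (H : Matrix (Fin N × Fin n) (Fin n) ℝ) (x : Fin n → ℝ) : Fin N → ℝ :=
  ((Gᵀ * G)⁻¹ * Gᵀ * H) *ᵥ x

/-- The LQ gain (row vector) `K := −(BᵀPB)⁻¹BᵀPA`. -/
def Kgain {n : ℕ} (A P : Matrix (Fin n) (Fin n) ℝ) (B : Fin n → ℝ) : Fin n → ℝ :=
  -((B ⬝ᵥ (P *ᵥ B))⁻¹ • Matrix.vecMul B (P * A))

/-- The closed-loop matrix `A + BK`. -/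
def Acl {n : ℕ} (A P : Matrix (Fin n) (Fin n) ℝ) (B : Fin n → ℝ) :
    Matrix (Fin n) (Fin n) ℝ :=
  A + Matrix.vecMulVec B (Kgain A P B)

/-- The discrete algebraic Riccati equation
`P = AᵀPA − AᵀPB(BᵀPB)⁻¹BᵀPA + Q`. -/
def Riccati {n : ℕ} (A P Q : Matrix (Fin n) (Fin n) ℝ) (B : Fin n → ℝ) : Prop :=
  P = Aᵀ * P * A -
      (B ⬝ᵥ (P *ᵥ B))⁻¹ •
        Matrix.vecMulVec (Aᵀ *ᵥ (P *ᵥ B)) (Matrix.vecMul B (P * A)) + Q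

/-- The Lyapunov function `V(x) := xᵀPx`. -/
def Vfun {n : ℕ} (P : Matrix (Fin n) (Fin n) ℝ) (x : Fin n → ℝ) : ℝ :=
  x ⬝ᵥ (P *ᵥ x)

/-- `c₁ := max_{i=0,…,N−1} λ_max(Φᵢᵀ P Φᵢ (GᵀG)⁻¹)`. -/
def c1const (n N : ℕ) (A P : Matrix (Fin n) (Fin n) ℝ) (B : Fin n → ℝ)
    (G : Matrix (Fin N × Fin n) (Fin N) ℝ) : ℝ :=
  ⨆ i : Fin N,
    sSup (spectrum ℝ ((PhiBlock n N A B i)ᵀ * P * PhiBlock n N A B i * (Gᵀ * G)⁻¹))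

/-- `ρ := 1 − λ_min(QP⁻¹)`. -/
def rhoConst {n : ℕ} (Q P : Matrix (Fin n) (Fin n) ℝ) : ℝ :=
  1 - sInf (spectrum ℝ (Q * P⁻¹))

/-- `c := (1−ρ)⁻¹(1−ρ^N)c₁`. -/
def cConst (n N : ℕ) (A P Q : Matrix (Fin n) (Fin n) ℝ) (B : Fin n → ℝ)
    (G : Matrix (Fin N × Fin n) (Fin N) ℝ) : ℝ :=
  (1 - rhoConst Q P)⁻¹ * (1 - rhoConst Q P ^ N) * c1const n N A P B G

/-- `w_i := ε_i − K Σ_{l=0}^{i−1} A^{i−1−l} B ε_l`. -/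
def wErr {n N : ℕ} (A P : Matrix (Fin n) (Fin n) ℝ) (B : Fin n → ℝ)
    (ε : Fin N → ℝ) (i : Fin N) : ℝ :=
  ε i - Kgain A P B ⬝ᵥ
    (∑ l ∈ Finset.univ.filter (fun l : Fin N => (l : ℕ) < (i : ℕ)),
      ε l • ((A ^ ((i : ℕ) - 1 - (l : ℕ))) *ᵥ B))

/-- The controllability matrix `[B, AB, …, A^{n−1}B]`. -/
def Ctrb {n : ℕ} (A : Matrix (Fin n) (Fin n) ℝ) (B : Fin n → ℝ) :
    Matrix (Fin n) (Fin n) ℝ :=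
  Matrix.of fun r j => ((A ^ (j : ℕ)) *ᵥ B) r

open scoped MatrixOrder in
lemma aux_spec {n : ℕ} (hn : 0 < n) (X P : Matrix (Fin n) (Fin n) ℝ) (hX : X.PosDef) (hP : P.PosDef) :
    0 < sInf (spectrum ℝ (X * P⁻¹)) ∧
    ∀ x : Fin n → ℝ, sInf (spectrum ℝ (X * P⁻¹)) * (x ⬝ᵥ (P *ᵥ x)) ≤ x ⬝ᵥ (X *ᵥ x) := by
  obtain ⟨R, hR, hRR⟩ : ∃ R : Matrix (Fin n) (Fin n) ℝ, R.PosSemidef ∧ R * R = P :=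
    ⟨CFC.sqrt P, (CFC.sqrt_nonneg P).posSemidef, CFC.sqrt_mul_sqrt_self P hP.posSemidef.nonneg⟩
  have hRu : IsUnit R := by
    have : IsUnit (R * R) := hRR ▸ hP.isUnit
    exact isUnit_of_mul_isUnit_left this
  have hRd : IsUnit R.det := (Matrix.isUnit_iff_isUnit_det R).1 hRu
  have hRH : Rᴴ = R := hR.isHermitian
  have hRT : Rᵀ = R := by rw [← Matrix.conjTranspose_eq_transpose_of_trivial, hRH]
  have hRiH : star R⁻¹ = R⁻¹ := by
    rw [Matrix.star_eq_conjTranspose, Matrix.conjTranspose_nonsing_inv, hRH]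
  have hRiu : IsUnit R⁻¹ := (Matrix.isUnit_nonsing_inv_iff).2 hRu
  obtain ⟨M, hM⟩ : ∃ M, M = R⁻¹ * X * R⁻¹ := ⟨_, rfl⟩
  have hMP : M.PosDef := by
    have := (Matrix.IsUnit.posDef_star_right_conjugate_iff (x := X) hRiu).2 hX
    rw [hRiH] at this
    rw [hM]; exact this
  have hspec : spectrum ℝ (X * P⁻¹) = spectrum ℝ M := by
    obtain ⟨r, rfl⟩ := hRu
    have h1 : X * P⁻¹ = (r : Matrix (Fin n) (Fin n) ℝ) * M * ((r⁻¹ : (Matrix (Fin n) (Fin n) ℝ)ˣ) : Matrix (Fin n) (Fin n) ℝ) := by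
      rw [hM, ← hRR, Matrix.mul_inv_rev, Matrix.coe_units_inv]
      simp only [← mul_assoc]
      rw [Matrix.mul_nonsing_inv _ hRd, one_mul]
    rw [h1, spectrum.units_conjugate]
  rw [hspec]
  have hne : (spectrum ℝ M).Nonempty := ⟨_, hMP.1.eigenvalues_mem_spectrum_real ⟨0, hn⟩⟩
  have hfin : (spectrum ℝ M).Finite := M.finite_real_spectrum
  have hmem := hne.csInf_mem hfin
  set μ := sInf (spectrum ℝ M) with hμ
  constructor
  · rw [hMP.1.spectrum_real_eq_range_eigenvalues] at hmem
    obtain ⟨i, hi⟩ := hmem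
    rw [← hi]; exact hMP.eigenvalues_pos i
  · have hpsd : (M - algebraMap ℝ _ μ).PosSemidef := by
      rw [Matrix.posSemidef_iff_isHermitian_and_spectrum_nonneg]
      constructor
      · refine hMP.1.sub ?_
        rw [Matrix.IsHermitian, Matrix.algebraMap_eq_diagonal]
        simp
      · intro a ha
        rw [← spectrum.sub_singleton_eq] at ha
        obtain ⟨b, hb, c, hc, rfl⟩ := ha
        have : c = μ := hc
        subst this
        exact sub_nonneg.2 (csInf_le hfin.bddBelow hb)
    intro x
    have h := hpsd.dotProduct_mulVec_nonneg (R *ᵥ x)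
    have e1 : (R *ᵥ x) ⬝ᵥ (M *ᵥ (R *ᵥ x)) = x ⬝ᵥ (X *ᵥ x) := by
      rw [hM, Matrix.mulVec_mulVec, mul_assoc, Matrix.nonsing_inv_mul _ hRd, mul_one,
        Matrix.dotProduct_mulVec, ← Matrix.vecMul_transpose, Matrix.vecMul_vecMul, hRT,
        ← mul_assoc, Matrix.mul_nonsing_inv _ hRd, one_mul, Matrix.dotProduct_mulVec]
    have e2 : (R *ᵥ x) ⬝ᵥ (R *ᵥ x) = x ⬝ᵥ (P *ᵥ x) := by
      rw [Matrix.dotProduct_mulVec, ← Matrix.vecMul_transpose, Matrix.vecMul_vecMul, hRT, hRR,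
         Matrix.dotProduct_mulVec]
    rw [star_trivial, Matrix.sub_mulVec, dotProduct_sub, e1, Algebra.algebraMap_eq_smul_one,
      Matrix.smul_mulVec, Matrix.one_mulVec, dotProduct_smul, e2, smul_eq_mul] at h
    linarith

/-- The optimal scalar feedback. -/
def kap {n : ℕ} (A P : Matrix (Fin n) (Fin n) ℝ) (B : Fin n → ℝ) (x : Fin n → ℝ) : ℝ :=
  -((B ⬝ᵥ (P *ᵥ B))⁻¹ * (B ⬝ᵥ (P *ᵥ (A *ᵥ x))))

lemma aux_symm {n : ℕ} {P : Matrix (Fin n) (Fin n) ℝ} (hP : P.PosDef) (x y : Fin n → ℝ) :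
    x ⬝ᵥ (P *ᵥ y) = y ⬝ᵥ (P *ᵥ x) := by
  have hT : Pᵀ = P := by
    rw [← Matrix.conjTranspose_eq_transpose_of_trivial]; exact hP.isHermitian
  rw [Matrix.dotProduct_mulVec, ← Matrix.mulVec_transpose, hT, dotProduct_comm]

lemma aux_ric {n : ℕ} {A P Q : Matrix (Fin n) (Fin n) ℝ} {B : Fin n → ℝ} (hP : P.PosDef)
    (hRic : Riccati A P Q B) (z x : Fin n → ℝ) :
    z ⬝ᵥ (P *ᵥ x) = (A *ᵥ z) ⬝ᵥ (P *ᵥ (A *ᵥ x)) -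
      (B ⬝ᵥ (P *ᵥ B))⁻¹ * ((B ⬝ᵥ (P *ᵥ (A *ᵥ z))) * (B ⬝ᵥ (P *ᵥ (A *ᵥ x)))) + z ⬝ᵥ (Q *ᵥ x) := by
  unfold Riccati at hRic
  have h1 : z ⬝ᵥ ((Aᵀ * P * A) *ᵥ x) = (A *ᵥ z) ⬝ᵥ (P *ᵥ (A *ᵥ x)) := by
    rw [← Matrix.mulVec_mulVec, ← Matrix.mulVec_mulVec, Matrix.dotProduct_mulVec,
      Matrix.vecMul_transpose]
  have h2 : z ⬝ᵥ ((Matrix.vecMulVec (Aᵀ *ᵥ (P *ᵥ B)) (Matrix.vecMul B (P * A))) *ᵥ x)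
      = (B ⬝ᵥ (P *ᵥ (A *ᵥ z))) * (B ⬝ᵥ (P *ᵥ (A *ᵥ x))) := by
    rw [Matrix.vecMulVec_mulVec, ← Matrix.dotProduct_mulVec, ← Matrix.mulVec_mulVec]
    rw [dotProduct_smul, Matrix.dotProduct_mulVec z, Matrix.vecMul_transpose, aux_symm hP (A *ᵥ z)]
    simp
  calc z ⬝ᵥ (P *ᵥ x) = z ⬝ᵥ ((Aᵀ * P * A - (B ⬝ᵥ (P *ᵥ B))⁻¹ •
        Matrix.vecMulVec (Aᵀ *ᵥ (P *ᵥ B)) (Matrix.vecMul B (P * A)) + Q) *ᵥ x) := by rw [← hRic]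
    _ = _ := by
      rw [Matrix.add_mulVec, Matrix.sub_mulVec, dotProduct_add, dotProduct_sub,
        Matrix.smul_mulVec, dotProduct_smul, h1, h2, smul_eq_mul]

/-- Completion of squares for one step. -/
lemma aux_step {n : ℕ} {A P Q : Matrix (Fin n) (Fin n) ℝ} {B : Fin n → ℝ} (hP : P.PosDef)
    (hβ : 0 < B ⬝ᵥ (P *ᵥ B)) (hRic : Riccati A P Q B) (x : Fin n → ℝ) (v : ℝ) :
    (A *ᵥ x + v • B) ⬝ᵥ (P *ᵥ (A *ᵥ x + v • B)) = x ⬝ᵥ (P *ᵥ x) - x ⬝ᵥ (Q *ᵥ x) +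
      (B ⬝ᵥ (P *ᵥ B)) * (v - kap A P B x) ^ 2 := by
  rw [aux_ric hP hRic x x]
  simp only [kap, Matrix.mulVec_add, Matrix.mulVec_smul, dotProduct_add, add_dotProduct,
    smul_dotProduct, dotProduct_smul, smul_eq_mul]
  rw [aux_symm hP (A *ᵥ x) B]
  field_simp
  ring

lemma aux_step2 {n : ℕ} {A P Q : Matrix (Fin n) (Fin n) ℝ} {B : Fin n → ℝ} (hP : P.PosDef)
    (hβ : 0 < B ⬝ᵥ (P *ᵥ B)) (hRic : Riccati A P Q B) (z x : Fin n → ℝ) (v : ℝ) :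
    (A *ᵥ z + v • B) ⬝ᵥ (P *ᵥ (A *ᵥ x + (kap A P B x) • B)) = z ⬝ᵥ (P *ᵥ x) - z ⬝ᵥ (Q *ᵥ x) := by
  rw [aux_ric hP hRic z x]
  simp only [kap, Matrix.mulVec_add, Matrix.mulVec_smul, dotProduct_add, add_dotProduct,
    smul_dotProduct, dotProduct_smul, smul_eq_mul]
  rw [aux_symm hP (A *ᵥ z) B]
  field_simp
  ring

lemma aux_closed {n : ℕ} {A : Matrix (Fin n) (Fin n) ℝ} {B : Fin n → ℝ} (v : ℕ → ℝ)
    (z : ℕ → Fin n → ℝ) (hz : ∀ t, z (t + 1) = A *ᵥ z t + v t • B) (t : ℕ) :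
    z (t + 1) = A ^ (t + 1) *ᵥ z 0 + ∑ l ∈ Finset.range (t + 1), v l • (A ^ (t - l) *ᵥ B) := by
  induction t with
  | zero => simp [hz]
  | succ t ih =>
    rw [hz (t + 1), ih, Finset.sum_range_succ _ (t + 1), Matrix.mulVec_add, Matrix.mulVec_mulVec,
      ← pow_succ', add_assoc, Matrix.mulVec_sum]
    congr 2
    · refine Finset.sum_congr rfl fun l hl => ?_
      have hl' : t + 1 - l = (t - l) + 1 := by
        have := Finset.mem_range.1 hl
        omega
      rw [Matrix.mulVec_smul, Matrix.mulVec_mulVec, ← pow_succ', hl']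
    · simp

lemma aux_traj {n N : ℕ} {A : Matrix (Fin n) (Fin n) ℝ} {B : Fin n → ℝ} (v : ℕ → ℝ)
    (z : ℕ → Fin n → ℝ) (hz : ∀ t, z (t + 1) = A *ᵥ z t + v t • B) (p : Fin N × Fin n) :
    (Phi n N A B *ᵥ (fun i : Fin N => v i) + Upsilon n N A *ᵥ (z 0)) p = z (p.1 + 1) p.2 := by
  obtain ⟨i, r⟩ := p
  rw [aux_closed v z hz, add_comm]
  simp only [Pi.add_apply, Finset.sum_apply, Pi.smul_apply, smul_eq_mul]
  congr 1
  simp only [Phi, Matrix.mulVec, dotProduct, Matrix.of_apply, ite_mul, zero_mul]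
  rw [Fin.sum_univ_eq_sum_range (fun j => if j ≤ (i : ℕ) then (∑ s, (A ^ ((i : ℕ) - j)) r s * B s) * v j else 0) N,
    ← Finset.sum_filter]
  refine Finset.sum_congr ?_ fun l _ => mul_comm _ _
  ext l
  have := i.2
  simp only [Finset.mem_filter, Finset.mem_range]
  omega

lemma aux_qbar {n M : ℕ} (Q P : Matrix (Fin n) (Fin n) ℝ) (a b : ℕ → Fin n → ℝ) :
    (fun p : Fin (M + 1) × Fin n => a (p.1 + 1) p.2) ⬝ᵥ
      (Qbar n (M + 1) Q P *ᵥ (fun p : Fin (M + 1) × Fin n => b (p.1 + 1) p.2)) =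
    ∑ i ∈ Finset.range M, a (i + 1) ⬝ᵥ (Q *ᵥ b (i + 1)) + a (M + 1) ⬝ᵥ (P *ᵥ b (M + 1)) := by
  have h : ∀ (i : Fin (M + 1)) (r : Fin n),
      (Qbar n (M + 1) Q P *ᵥ (fun p : Fin (M + 1) × Fin n => b (p.1 + 1) p.2)) (i, r) =
        ((if (i : ℕ) = M then P else Q) *ᵥ b (i + 1)) r := by
    intro i r
    simp only [Matrix.mulVec, dotProduct, Qbar, Matrix.of_apply, Fintype.sum_prod_type]
    rw [Finset.sum_eq_single i]
    · simp
    · intro j _ hj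
      simp [Ne.symm hj]
    · simp
  rw [dotProduct, Fintype.sum_prod_type]
  simp only [h]
  rw [Fin.sum_univ_eq_sum_range (fun i => ∑ r, a (i + 1) r * ((if i = M then P else Q) *ᵥ b (i + 1)) r) (M + 1),
    Finset.sum_range_succ]
  congr 1
  · refine Finset.sum_congr rfl fun l hl => ?_
    rw [if_neg (Finset.mem_range.1 hl).ne]; rfl
  · simp [dotProduct]

lemma aux_GH {n M : ℕ} {A Q P : Matrix (Fin n) (Fin n) ℝ} {B : Fin n → ℝ}
    {S : Matrix (Fin (M + 1) × Fin n) (Fin (M + 1) × Fin n) ℝ}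
    (hS : S.PosSemidef) (hSsq : S * S = Qbar n (M + 1) Q P)
    (v v' : ℕ → ℝ) (z z' : ℕ → Fin n → ℝ) (hz : ∀ t, z (t + 1) = A *ᵥ z t + v t • B)
    (hz' : ∀ t, z' (t + 1) = A *ᵥ z' t + v' t • B) :
    ((S * Phi n (M + 1) A B) *ᵥ (fun i : Fin (M + 1) => v i) - (-(S * Upsilon n (M + 1) A)) *ᵥ (z 0)) ⬝ᵥ
    ((S * Phi n (M + 1) A B) *ᵥ (fun i : Fin (M + 1) => v' i) - (-(S * Upsilon n (M + 1) A)) *ᵥ (z' 0)) =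
    ∑ i ∈ Finset.range M, z (i + 1) ⬝ᵥ (Q *ᵥ z' (i + 1)) + z (M + 1) ⬝ᵥ (P *ᵥ z' (M + 1)) := by
  have hST : Sᵀ = S := by
    rw [← Matrix.conjTranspose_eq_transpose_of_trivial]; exact hS.isHermitian
  have key : ∀ (v : ℕ → ℝ) (z : ℕ → Fin n → ℝ) (hz : ∀ t, z (t + 1) = A *ᵥ z t + v t • B),
    ((S * Phi n (M + 1) A B) *ᵥ (fun i : Fin (M + 1) => v i) - (-(S * Upsilon n (M + 1) A)) *ᵥ (z 0))
      = S *ᵥ (fun p : Fin (M + 1) × Fin n => z (p.1 + 1) p.2) := by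
    intro v z hz
    rw [Matrix.neg_mulVec, sub_neg_eq_add, ← Matrix.mulVec_mulVec, ← Matrix.mulVec_mulVec,
      ← Matrix.mulVec_add]
    congr 1
    ext p
    exact aux_traj v z hz p
  rw [key v z hz, key v' z' hz', Matrix.dotProduct_mulVec, ← Matrix.vecMul_transpose,
    Matrix.vecMul_vecMul, hST, hSsq, ← Matrix.dotProduct_mulVec, aux_qbar]

lemma aux_tele {n : ℕ} {A P Q : Matrix (Fin n) (Fin n) ℝ} {B : Fin n → ℝ} (hP : P.PosDef)
    (hβ : 0 < B ⬝ᵥ (P *ᵥ B)) (hRic : Riccati A P Q B)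
    (v : ℕ → ℝ) (z : ℕ → Fin n → ℝ) (hz : ∀ t, z (t + 1) = A *ᵥ z t + v t • B) (M : ℕ) :
    ∑ i ∈ Finset.range M, z (i + 1) ⬝ᵥ (Q *ᵥ z (i + 1)) + z (M + 1) ⬝ᵥ (P *ᵥ z (M + 1)) =
    z 0 ⬝ᵥ (P *ᵥ z 0) - z 0 ⬝ᵥ (Q *ᵥ z 0) +
      ∑ i ∈ Finset.range (M + 1), (B ⬝ᵥ (P *ᵥ B)) * (v i - kap A P B (z i)) ^ 2 := by
  induction M with
  | zero => simp [hz, aux_step hP hβ hRic]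
  | succ M ih =>
    rw [Finset.sum_range_succ, Finset.sum_range_succ _ (M + 1), hz (M + 1), aux_step hP hβ hRic]
    linarith

/-- Optimal trajectory from the origin with unit initial impulse. -/
def optTraj {n : ℕ} (A P : Matrix (Fin n) (Fin n) ℝ) (B : Fin n → ℝ) : ℕ → Fin n → ℝ
  | 0 => 0
  | 1 => B
  | (t + 2) => A *ᵥ (optTraj A P B (t + 1)) + kap A P B (optTraj A P B (t + 1)) • B

lemma aux_tele2 {n : ℕ} {A P Q : Matrix (Fin n) (Fin n) ℝ} {B : Fin n → ℝ} (hP : P.PosDef)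
    (hβ : 0 < B ⬝ᵥ (P *ᵥ B)) (hRic : Riccati A P Q B)
    (v : ℕ → ℝ) (z : ℕ → Fin n → ℝ) (hz0 : z 0 = 0)
    (hz : ∀ t, z (t + 1) = A *ᵥ z t + v t • B) (M : ℕ) :
    ∑ i ∈ Finset.range M, z (i + 1) ⬝ᵥ (Q *ᵥ optTraj A P B (i + 1)) +
      z (M + 1) ⬝ᵥ (P *ᵥ optTraj A P B (M + 1)) = v 0 * (B ⬝ᵥ (P *ᵥ B)) := by
  induction M with
  | zero => simp [hz, hz0, optTraj]
  | succ M ih =>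
    rw [Finset.sum_range_succ, hz (M + 1), optTraj, aux_step2 hP hβ hRic]
    linarith

/-- Extend a packet to a sequence. -/
def ext0 {N : ℕ} (u : Fin N → ℝ) (t : ℕ) : ℝ := if h : t < N then u ⟨t, h⟩ else 0

/-- Predicted trajectory. -/
def predTraj {n : ℕ} (A : Matrix (Fin n) (Fin n) ℝ) (B : Fin n → ℝ) (v : ℕ → ℝ) (x : Fin n → ℝ) :
    ℕ → Fin n → ℝ
  | 0 => x
  | (t + 1) => A *ᵥ (predTraj A B v x t) + v t • B

lemma ext0_eq {N : ℕ} (u : Fin N → ℝ) : (fun i : Fin N => ext0 u i) = u := by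
  ext i; simp [ext0]

lemma aux_c1 {n M : ℕ} {A Q P : Matrix (Fin n) (Fin n) ℝ} {B : Fin n → ℝ}
    (hQ : Q.PosDef) (hP : P.PosDef)
    (hβ : 0 < B ⬝ᵥ (P *ᵥ B)) (hRic : Riccati A P Q B)
    {S : Matrix (Fin (M + 1) × Fin n) (Fin (M + 1) × Fin n) ℝ}
    (hS : S.PosSemidef) (hSsq : S * S = Qbar n (M + 1) Q P) :
    1 ≤ c1const n (M + 1) A P B (S * Phi n (M + 1) A B) := by
  set G := S * Phi n (M + 1) A B with hG
  set β := B ⬝ᵥ (P *ᵥ B) with hβd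
  have hB : B ≠ 0 := by
    rintro rfl
    simp at hβd
    exact hβ.ne' hβd
  -- bilinear identity
  have hbil : ∀ (v v' : ℕ → ℝ) (z z' : ℕ → Fin n → ℝ), z 0 = 0 → z' 0 = 0 →
      (∀ t, z (t + 1) = A *ᵥ z t + v t • B) → (∀ t, z' (t + 1) = A *ᵥ z' t + v' t • B) →
      (G *ᵥ (fun i : Fin (M + 1) => v i)) ⬝ᵥ (G *ᵥ (fun i : Fin (M + 1) => v' i)) =
      ∑ i ∈ Finset.range M, z (i + 1) ⬝ᵥ (Q *ᵥ z' (i + 1)) + z (M + 1) ⬝ᵥ (P *ᵥ z' (M + 1)) := by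
    intro v v' z z' h0 h0' hz hz'
    have := aux_GH hS hSsq v v' z z' hz hz'
    rw [h0, h0'] at this
    simpa using this
  have hquad : ∀ v : Fin (M + 1) → ℝ, ((Gᵀ * G) *ᵥ v) = 0 → v = 0 := by
    intro v hv
    have h1 : (G *ᵥ v) ⬝ᵥ (G *ᵥ v) = 0 := by
      rw [Matrix.dotProduct_mulVec, ← Matrix.vecMul_transpose, Matrix.vecMul_vecMul,
        ← Matrix.dotProduct_mulVec, hv, dotProduct_zero]
    have hz : ∀ t, predTraj A B (ext0 v) 0 (t + 1) = A *ᵥ predTraj A B (ext0 v) 0 t + ext0 v t • B :=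
      fun t => rfl
    have h2 := hbil (ext0 v) (ext0 v) _ _ rfl rfl hz hz
    rw [ext0_eq, h1] at h2
    have hQn : ∀ x : Fin n → ℝ, 0 ≤ x ⬝ᵥ (Q *ᵥ x) := fun x => by
      simpa using hQ.posSemidef.dotProduct_mulVec_nonneg x
    have hPn : ∀ x : Fin n → ℝ, 0 ≤ x ⬝ᵥ (P *ᵥ x) := fun x => by
      simpa using hP.posSemidef.dotProduct_mulVec_nonneg x
    have hQz : ∀ x : Fin n → ℝ, x ⬝ᵥ (Q *ᵥ x) = 0 → x = 0 := fun x hx => by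
      by_contra h
      have := hQ.dotProduct_mulVec_pos h
      simp [hx] at this
    have hPz : ∀ x : Fin n → ℝ, x ⬝ᵥ (P *ᵥ x) = 0 → x = 0 := fun x hx => by
      by_contra h
      have := hP.dotProduct_mulVec_pos h
      simp [hx] at this
    set z := predTraj A B (ext0 v) 0
    have hs : 0 ≤ ∑ i ∈ Finset.range M, z (i + 1) ⬝ᵥ (Q *ᵥ z (i + 1)) :=
      Finset.sum_nonneg fun i _ => hQn _
    have hl := hPn (z (M + 1))
    have hs0 : ∑ i ∈ Finset.range M, z (i + 1) ⬝ᵥ (Q *ᵥ z (i + 1)) = 0 := by linarith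
    have hl0 : z (M + 1) = 0 := hPz _ (by linarith)
    have hz0 : ∀ t, t ≤ M + 1 → z t = 0 := by
      intro t ht
      rcases t with _ | t
      · rfl
      · rcases Nat.lt_or_ge t M with h | h
        · exact hQz _ ((Finset.sum_eq_zero_iff_of_nonneg fun i _ => hQn _).1 hs0 t
            (Finset.mem_range.2 h))
        · have : t = M := by omega
          rw [this]; exact hl0
    ext i
    have h3 := hz i
    rw [hz0 _ (by have := i.2; omega), hz0 _ (by have := i.2; omega)] at h3
    have h4 : ext0 v i = v i := congrFun (ext0_eq v) i
    rw [h4] at h3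
    simp only [Matrix.mulVec_zero, zero_add] at h3
    rcases smul_eq_zero.1 h3.symm with h | h
    · exact h
    · exact absurd h hB
  have hunit : IsUnit (Gᵀ * G) := by
    rw [← Matrix.mulVec_injective_iff_isUnit]
    intro a b hab
    have := hquad (a - b) (by rw [Matrix.mulVec_sub]; exact sub_eq_zero.2 hab)
    exact sub_eq_zero.1 this
  have hdet := (Matrix.isUnit_iff_isUnit_det _).1 hunit
  -- the eigenvector
  let v' : ℕ → ℝ := fun t => if t = 0 then 1 else kap A P B (optTraj A P B t)
  have hz' : ∀ t, optTraj A P B (t + 1) = A *ᵥ optTraj A P B t + v' t • B := by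
    intro t
    rcases t with _ | t
    · simp [optTraj, v']
    · simp [optTraj, v']
  let u : Fin (M + 1) → ℝ := fun i => v' i
  let e0 : Fin (M + 1) → ℝ := Pi.single 0 1
  have hGu : (Gᵀ * G) *ᵥ u = β • e0 := by
    refine dotProduct_eq _ _ fun w => ?_
    have hz : ∀ t, predTraj A B (ext0 w) 0 (t + 1) = A *ᵥ predTraj A B (ext0 w) 0 t + ext0 w t • B :=
      fun t => rfl
    have h2 := hbil (ext0 w) v' _ _ rfl rfl hz hz'
    rw [aux_tele2 hP hβ hRic _ _ rfl hz, ext0_eq] at h2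
    rw [dotProduct_comm, ← Matrix.mulVec_mulVec, Matrix.dotProduct_mulVec, Matrix.vecMul_transpose, h2]
    simp [e0, ext0, mul_comm, hβd]
  have hinv : (Gᵀ * G)⁻¹ *ᵥ e0 = β⁻¹ • u := by
    have : e0 = β⁻¹ • ((Gᵀ * G) *ᵥ u) := by
      rw [hGu, smul_smul, inv_mul_cancel₀ hβ.ne', one_smul]
    rw [this, Matrix.mulVec_smul, Matrix.mulVec_mulVec, Matrix.nonsing_inv_mul _ hdet,
      Matrix.one_mulVec]
  have hPhi : ∀ w : Fin (M + 1) → ℝ, PhiBlock n (M + 1) A B 0 *ᵥ w = w 0 • B := by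
    intro w
    ext r
    simp only [PhiBlock, Phi, Matrix.mulVec, dotProduct, Matrix.of_apply]
    rw [Finset.sum_eq_single 0]
    · simp [mul_comm, Matrix.one_apply]
    · intro j _ hj
      have : ¬ ((j : ℕ) ≤ 0) := by
        intro h
        apply hj
        ext
        simpa using h
      simp [hj]
    · simp
  have hPhiT : (PhiBlock n (M + 1) A B 0)ᵀ *ᵥ (P *ᵥ B) = β • e0 := by
    refine dotProduct_eq _ _ fun w => ?_
    rw [dotProduct_comm, Matrix.dotProduct_mulVec, Matrix.vecMul_transpose, hPhi]
    simp [e0, mul_comm, hβd]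
  set MM := (PhiBlock n (M + 1) A B 0)ᵀ * P * PhiBlock n (M + 1) A B 0 * (Gᵀ * G)⁻¹ with hMM
  have heig : MM *ᵥ e0 = e0 := by
    rw [hMM, ← Matrix.mulVec_mulVec, hinv, ← Matrix.mulVec_mulVec, hPhi, Matrix.mulVec_smul,
      ← Matrix.mulVec_mulVec, hPhiT]
    simp [u, v', smul_smul, hβ.ne']
  have hmem : (1 : ℝ) ∈ spectrum ℝ MM := by
    rw [spectrum.mem_iff]
    intro hu
    rw [← Matrix.mulVec_injective_iff_isUnit] at hu
    have : e0 = 0 := hu (by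
      show (algebraMap ℝ _ 1 - MM) *ᵥ e0 = (algebraMap ℝ _ 1 - MM) *ᵥ 0
      rw [map_one, Matrix.sub_mulVec, Matrix.one_mulVec, heig, Matrix.mulVec_zero, sub_self])
    have h := congrFun this 0
    simp [e0] at h
  calc (1 : ℝ) ≤ sSup (spectrum ℝ MM) := le_csSup MM.finite_real_spectrum.bddAbove hmem
    _ ≤ _ := le_ciSup (f := fun i : Fin (M + 1) => sSup (spectrum ℝ ((PhiBlock n (M + 1) A B i)ᵀ * P *
        PhiBlock n (M + 1) A B i * (Gᵀ * G)⁻¹))) (Set.finite_range _).bddAbove 0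

/-- Asymptotic Stability, main theorem: With `(A,B)` reachable,
`Q > 0` arbitrary, `P > 0` solving the DARE, `ρ`, `c₁`, `c` as computed,
`0 < ℰ < (1−ρ)P/c` and `W := (P − Q) + ℰ`, the noise-free networked loop with
bounded packet dropouts (`k_0 = 0`, `k_{i+1} − k_i − 1 ≤ N − 1`), with arbitrary
feasible buffered packets, is asymptotically stable: `x(k) → 0` as `k → ∞` for
every initial state. -/
theorem networked_asymptotic_stability {n N : ℕ} (hN : 1 ≤ N)
    (A : Matrix (Fin n) (Fin n) ℝ) (B : Fin n → ℝ)
    (hreach : (Ctrb A B).rank = n)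
    (Q P : Matrix (Fin n) (Fin n) ℝ) (hQ : Q.PosDef) (hP : P.PosDef)
    (hRic : Riccati A P Q B)
    (S : Matrix (Fin N × Fin n) (Fin N × Fin n) ℝ)
    (hS : S.PosSemidef) (hSsq : S * S = Qbar n N Q P)
    (G : Matrix (Fin N × Fin n) (Fin N) ℝ) (hG : G = S * Phi n N A B)
    (H : Matrix (Fin N × Fin n) (Fin n) ℝ) (hH : H = -(S * Upsilon n N A))
    (E : Matrix (Fin n) (Fin n) ℝ) (hE : E.PosDef)
    (hEub : (((1 - rhoConst Q P) / cConst n N A P Q B G) • P - E).PosDef)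
    (k : ℕ → ℕ) (hk0 : k 0 = 0) (hkmono : StrictMono k)
    (hkbound : ∀ i : ℕ, k (i + 1) ≤ k i + N)
    (U : ℕ → Fin N → ℝ) (uin : ℕ → ℝ) (xst : ℕ → Fin n → ℝ)
    (hfeas : ∀ i : ℕ, U i ∈ Feas G H ((P - Q) + E) (xst (k i)))
    (hinput : ∀ (i : ℕ) (l : Fin N),
      k i + (l : ℕ) < k (i + 1) → uin (k i + (l : ℕ)) = U i l)
    (hdyn : ∀ t : ℕ, xst (t + 1) = A *ᵥ xst t + uin t • B) :
    Filter.Tendsto xst Filter.atTop (nhds 0) := by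
  rcases Nat.eq_zero_or_pos n with rfl | hn
  · have : xst = fun _ => 0 := by
      ext t r
      exact r.elim0
    rw [this]
    exact tendsto_const_nhds
  obtain ⟨M, rfl⟩ : ∃ M, N = M + 1 := ⟨N - 1, by omega⟩
  subst hG hH
  have hB : B ≠ 0 := by
    rintro rfl
    have h0 : Ctrb A (0 : Fin n → ℝ) = 0 := by
      ext r j
      simp [Ctrb]
    rw [h0, Matrix.rank_zero] at hreach
    omega
  have hβ : 0 < B ⬝ᵥ (P *ᵥ B) := by simpa using hP.dotProduct_mulVec_pos hB
  have hPn : ∀ x : Fin n → ℝ, 0 ≤ x ⬝ᵥ (P *ᵥ x) := fun x => by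
    simpa using hP.posSemidef.dotProduct_mulVec_nonneg x
  obtain ⟨hμ0, hμ⟩ := aux_spec hn Q P hQ hP
  have hc1 := aux_c1 hQ hP hβ hRic hS hSsq
  have hρ : rhoConst Q P = 1 - sInf (spectrum ℝ (Q * P⁻¹)) := rfl
  set μ := sInf (spectrum ℝ (Q * P⁻¹))
  have hμ1 : μ ≤ 1 := by
    have h1 := aux_step hP hβ hRic B (kap A P B B)
    have h2 := hPn (A *ᵥ B + (kap A P B B) • B)
    have h3 := hμ B
    rw [sub_self] at h1
    have h4 : μ * (B ⬝ᵥ (P *ᵥ B)) ≤ 1 * (B ⬝ᵥ (P *ᵥ B)) := by linarith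
    exact le_of_mul_le_mul_right h4 hβ
  set c := cConst n (M + 1) A P Q B (S * Phi n (M + 1) A B) with hcdef
  have hc : 1 ≤ c := by
    rw [hcdef, cConst, hρ]
    have h1 : 1 - (1 - μ) = μ := by ring
    have h2 : (1 - μ) ^ (M + 1) ≤ 1 - μ := by
      rw [pow_succ]
      exact mul_le_of_le_one_left (by linarith) (pow_le_one₀ (by linarith) (by linarith))
    have h3 : 1 ≤ μ⁻¹ * (1 - (1 - μ) ^ (M + 1)) := by
      rw [inv_mul_eq_div, one_le_div hμ0]
      linarith
    rw [h1]
    exact one_le_mul_of_one_le_of_one_le h3 hc1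
  obtain ⟨hδ0, hδ⟩ := aux_spec hn _ P hEub hP
  set δ := sInf (spectrum ℝ ((((1 - rhoConst Q P) / c) • P - E) * P⁻¹))
  have hEb : ∀ x : Fin n → ℝ, x ⬝ᵥ (E *ᵥ x) ≤ (μ - δ) * (x ⬝ᵥ (P *ᵥ x)) := by
    intro x
    have h1 := hδ x
    rw [Matrix.sub_mulVec, dotProduct_sub, Matrix.smul_mulVec, dotProduct_smul, smul_eq_mul,
      hρ, sub_sub_cancel] at h1
    have h2 : μ / c * (x ⬝ᵥ (P *ᵥ x)) ≤ μ * (x ⬝ᵥ (P *ᵥ x)) :=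
      mul_le_mul_of_nonneg_right (div_le_self hμ0.le hc) (hPn x)
    linarith
  obtain ⟨V, hV⟩ : ∃ V : ℕ → ℝ, ∀ t, V t = xst t ⬝ᵥ (P *ᵥ xst t) := ⟨_, fun _ => rfl⟩
  have hV0 : ∀ t, 0 ≤ V t := fun t => by rw [hV]; exact hPn _
  -- contraction over one packet
  have hcontr : ∀ i j, k i + j < k (i + 1) → V (k i + (j + 1)) ≤ (1 - δ) * V (k i) := by
    intro i j hj
    have hjM : j < M + 1 := by have := hkbound i; omega
    set v := ext0 (U i) with hv
    set z := predTraj A B v (xst (k i)) with hzd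
    have hz : ∀ t, z (t + 1) = A *ᵥ z t + v t • B := fun t => rfl
    have hagree : ∀ t, k i + t ≤ k (i + 1) → z t = xst (k i + t) := by
      intro t
      induction t with
      | zero => intro _; rfl
      | succ t ih =>
        intro ht
        have htM : t < M + 1 := by have := hkbound i; omega
        rw [hz, ih (by omega), ← add_assoc, hdyn, hinput i ⟨t, htM⟩ (by simpa using (by omega))]
        simp [hv, ext0, htM]
    have hf : Jcost (S * Phi n (M + 1) A B) (-(S * Upsilon n (M + 1) A)) (xst (k i)) (U i) ≤
        xst (k i) ⬝ᵥ ((P - Q + E) *ᵥ xst (k i)) := hfeas i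
    have hJ := aux_GH hS hSsq v v z z hz hz
    rw [aux_tele hP hβ hRic v z hz M, hv, ext0_eq, ← hv] at hJ
    have hz0 : z 0 = xst (k i) := rfl
    rw [hz0] at hJ
    rw [Jcost, hJ, Matrix.add_mulVec, Matrix.sub_mulVec, dotProduct_add, dotProduct_sub] at hf
    have hsum : ∑ l ∈ Finset.range (M + 1), (B ⬝ᵥ (P *ᵥ B)) * (v l - kap A P B (z l)) ^ 2 ≤
        (μ - δ) * V (k i) := by
      rw [hV]
      have := hEb (xst (k i))
      linarith
    have hgrow : ∀ t, z (t + 1) ⬝ᵥ (P *ᵥ z (t + 1)) ≤ (1 - μ) * V (k i) +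
        ∑ l ∈ Finset.range (t + 1), (B ⬝ᵥ (P *ᵥ B)) * (v l - kap A P B (z l)) ^ 2 := by
      intro t
      induction t with
      | zero =>
        rw [hz, aux_step hP hβ hRic, hz0, hV]
        have := hμ (xst (k i))
        simp only [zero_add, Finset.sum_range_one, hz0]
        linarith
      | succ t ih =>
        rw [hz, aux_step hP hβ hRic, Finset.sum_range_succ]
        have h1 := hμ (z (t + 1))
        have h2 := mul_nonneg hμ0.le (hPn (z (t + 1)))
        linarith
    have hmono : ∑ l ∈ Finset.range (j + 1), (B ⬝ᵥ (P *ᵥ B)) * (v l - kap A P B (z l)) ^ 2 ≤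
        ∑ l ∈ Finset.range (M + 1), (B ⬝ᵥ (P *ᵥ B)) * (v l - kap A P B (z l)) ^ 2 := by
      refine Finset.sum_le_sum_of_subset_of_nonneg ?_ fun l _ _ => by positivity
      intro l
      simp only [Finset.mem_range]
      omega
    have h5 := hgrow j
    rw [hV, ← hagree (j + 1) (by omega)]
    linarith
  obtain ⟨γ, hγ0, hγ1, hγ⟩ : ∃ γ : ℝ, 0 ≤ γ ∧ γ < 1 ∧ 1 - δ ≤ γ :=
    ⟨max (1 - δ) 0, le_max_right _ _, max_lt (by linarith) one_pos, le_max_left _ _⟩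
  have hcontr2 : ∀ i j, k i + j < k (i + 1) → V (k i + (j + 1)) ≤ γ * V (k i) := fun i j hj =>
    (hcontr i j hj).trans (mul_le_mul_of_nonneg_right hγ (hV0 _))
  have hgeo : ∀ i, V (k i) ≤ γ ^ i * V 0 := by
    intro i
    induction i with
    | zero => simp [hk0]
    | succ i ih =>
      have hlt := hkmono (Nat.lt_succ_self i)
      have h1 := hcontr2 i (k (i + 1) - k i - 1) (by simp only [Nat.succ_eq_add_one] at hlt; omega)
      have h2 : k i + (k (i + 1) - k i - 1 + 1) = k (i + 1) := by
        simp only [Nat.succ_eq_add_one] at hlt; omega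
      rw [h2] at h1
      calc V (k (i + 1)) ≤ γ * V (k i) := h1
        _ ≤ γ * (γ ^ i * V 0) := mul_le_mul_of_nonneg_left ih hγ0
        _ = _ := by ring
  have hin : ∀ i t, k i ≤ t → t ≤ k (i + 1) → V t ≤ γ ^ i * V 0 := by
    intro i t h1 h2
    rcases h1.eq_or_lt with h | h
    · rw [← h]; exact hgeo i
    · have h3 := hcontr2 i (t - k i - 1) (by omega)
      have h4 : k i + (t - k i - 1 + 1) = t := by omega
      rw [h4] at h3
      have h5 : γ * V (k i) ≤ 1 * V (k i) := mul_le_mul_of_nonneg_right hγ1.le (hV0 _)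
      linarith [hgeo i]
  have hall : ∀ i t, k i ≤ t → V t ≤ γ ^ i * V 0 := by
    intro i t hit
    obtain ⟨d, hd⟩ : ∃ d, t ≤ k (i + d) := ⟨t, by have := hkmono.id_le (i + t); simp at this; omega⟩
    induction d generalizing i with
    | zero => exact hin i t hit (hd.trans (hkmono.monotone (by omega)))
    | succ d ih =>
      rcases le_total t (k (i + 1)) with h | h
      · exact hin i t hit h
      · have h1 := ih (i + 1) h (by rwa [show i + 1 + d = i + (d + 1) by omega])
        refine h1.trans (mul_le_mul_of_nonneg_right ?_ (hV0 0))
        exact pow_le_pow_of_le_one hγ0 hγ1.le (by omega)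
  have hVlim : Filter.Tendsto V Filter.atTop (nhds 0) := by
    have hg : Filter.Tendsto (fun i : ℕ => γ ^ i * V 0) Filter.atTop (nhds 0) := by
      simpa using (tendsto_pow_atTop_nhds_zero_of_lt_one hγ0 hγ1).mul_const (V 0)
    rw [Metric.tendsto_atTop] at hg ⊢
    intro ε hε
    obtain ⟨i, hi⟩ := hg ε hε
    refine ⟨k i, fun t ht => ?_⟩
    have h1 := hi i le_rfl
    rw [Real.dist_0_eq_abs] at h1 ⊢
    rw [abs_of_nonneg (hV0 t)]
    exact (hall i t ht).trans_lt ((le_abs_self _).trans_lt h1)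
  obtain ⟨hη0, hη⟩ := aux_spec hn P 1 hP Matrix.PosDef.one
  set η := sInf (spectrum ℝ (P * (1 : Matrix (Fin n) (Fin n) ℝ)⁻¹))
  rw [tendsto_pi_nhds]
  intro r
  have hsq : Filter.Tendsto (fun t => (xst t r) ^ 2) Filter.atTop (nhds 0) := by
    have hlim : Filter.Tendsto (fun t => η⁻¹ * V t) Filter.atTop (nhds 0) := by
      simpa using hVlim.const_mul η⁻¹
    refine squeeze_zero (fun t => sq_nonneg _) (fun t => ?_) hlim
    have h1 := hη (xst t)
    rw [Matrix.one_mulVec, ← hV] at h1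
    have h2 : (xst t r) ^ 2 ≤ xst t ⬝ᵥ xst t := by
      rw [dotProduct, pow_two]
      exact Finset.single_le_sum (f := fun s => xst t s * xst t s)
        (fun s _ => mul_self_nonneg _) (Finset.mem_univ r)
    rw [inv_mul_eq_div, le_div_iff₀ hη0]
    have h3 := mul_le_mul_of_nonneg_left h2 hη0.le
    linarith
  have := hsq.sqrt
  simp only [Real.sqrt_sq_eq_abs, Real.sqrt_zero] at this
  exact (tendsto_zero_iff_abs_tendsto_zero _).2 this
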